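/- arXiv:2109.05141 — 2 statements merged into one kernel-verified Lean document; each statement's English description precedes it below -/
import Mathlib

section
/- Let q, A, B, C, D, E be nonzero complex numbers with 0 < |q| < 1, generic in the sense that every q-shifted factorial and linear factor appearing in a denominator below is nonzero. Then for every integer N ≥ 0, S_{N+1}(A;C) = K_N(A;B,C,D,E)/(Cq³)^N + (A²q/(BDE))·[(1 − BDE/A)(1 − Cq³)(1 − BD/A)(1 − BE/A)(1 − DE/A)] / [(1 − BDEq/A)(1 − BCDEq/A²)(1 − Aq/B)(1 − Aq/D)(1 − Aq/E)]·S_N(Aq;Cq). -/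
/-- The bilateral `q`-shifted factorial `(a;q)_n` for `n ∈ ℤ`:
`(a;q)_0 = 1`, `(a;q)_n = ∏_{j=0}^{n-1} (1 - a q^j)` for `n ≥ 1`, and
`(a;q)_{-n} = 1 / ∏_{j=1}^{n} (1 - a q^{-j})` for `n ≥ 1`. -/
noncomputable def qPoch (q a : ℂ) (n : ℤ) : ℂ :=
  if 0 ≤ n then ∏ j ∈ Finset.range n.toNat, (1 - a * q ^ j)
  else (∏ j ∈ Finset.range (-n).toNat, (1 - a * q ^ (-(j : ℤ) - 1)))⁻¹

/-- The truncated very-well-poised `₆ψ₆` series `S_N(A,B,C,D,E)`: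
`Σ_{n=-N}^{N} [(1 - BDEq^{2n+1}/A)/(1 - BDEq/A)] ·
(Bq,Dq,Eq,BCDEq²/A²;q)_n / (DEq/A,BEq/A,BDq/A,A/C;q)_n · (1/(Cq²))^n`. -/
noncomputable def truncS (q A B C D E : ℂ) (N : ℕ) : ℂ :=
  ∑ n ∈ Finset.Icc (-(N : ℤ)) (N : ℤ),
    (1 - B*D*E*q^(2*n+1)/A) / (1 - B*D*E*q/A) *
    ((qPoch q (B*q) n * qPoch q (D*q) n * qPoch q (E*q) n * qPoch q (B*C*D*E*q^2/A^2) n) /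
     (qPoch q (D*E*q/A) n * qPoch q (B*E*q/A) n * qPoch q (B*D*q/A) n * qPoch q (A/C) n)) *
    (1/(C*q^2))^n

/-- The boundary quantity `K_N(A;B,C,D,E)` appearing in the recurrence
for the truncated `₆ψ₆` series. -/
noncomputable def Kterm (q A B C D E : ℂ) (N : ℕ) : ℂ :=
  q^((N : ℤ) - 2)/C * ((1 - B*D*E*q^(2*(N : ℤ)+3)/A) / (1 - B*D*E*q/A)) *
    ((qPoch q (B*q) ((N : ℤ)+1) * qPoch q (D*q) ((N : ℤ)+1) * qPoch q (E*q) ((N : ℤ)+1) *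
        qPoch q (B*C*D*E*q^2/A^2) ((N : ℤ)+1)) /
     (qPoch q (A/C) ((N : ℤ)+1) * qPoch q (B*D*q/A) ((N : ℤ)+1) *
        qPoch q (B*E*q/A) ((N : ℤ)+1) * qPoch q (D*E*q/A) ((N : ℤ)+1)))
  + B*D*E/C * (1 - q^((N : ℤ)-1)/A) *
    ((qPoch q (A/(B*D)) ((N : ℤ)+2) * qPoch q (A/(B*E)) ((N : ℤ)+2) *
        qPoch q (A/(D*E)) ((N : ℤ)+2) * qPoch q (C/A) ((N : ℤ)+2)) /
     ((1 - C/A) * (1 - A*q/B) * (1 - A*q/D) * (1 - A*q/E) * (1 - B*D*E*q/A) *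
      (qPoch q (1/B) ((N : ℤ)+1) * qPoch q (1/D) ((N : ℤ)+1) * qPoch q (1/E) ((N : ℤ)+1) *
        qPoch q (A^2/(B*C*D*E*q)) ((N : ℤ)+1))))
  - A^2*q/(B*D*E) *
    (((1 - B*q) * (1 - D*q) * (1 - E*q) * (1 - B*D*E*q^((N : ℤ)-1)/A^2)) *
     (qPoch q (B*C*D*E*q^2/A^2) (N : ℤ) * qPoch q (B*q^2) (N : ℤ) *
        qPoch q (D*q^2) (N : ℤ) * qPoch q (E*q^2) (N : ℤ)) /
     ((1 - A*q/B) * (1 - A*q/D) * (1 - A*q/E) * (1 - B*D*E*q/A) *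
      (qPoch q (A/C) (N : ℤ) * qPoch q (B*D*q/A) (N : ℤ) *
        qPoch q (B*E*q/A) (N : ℤ) * qPoch q (D*E*q/A) (N : ℤ))))

theorem qPoch_ofNat (q a : ℂ) (n : ℕ) :
    qPoch q a n = ∏ j ∈ Finset.range n, (1 - a * q ^ j) := by
  simp [qPoch]

theorem qPoch_neg_ofNat (q a : ℂ) (n : ℕ) :
    qPoch q a (-(n : ℤ)) = (∏ j ∈ Finset.range n, (1 - a * q ^ (-(j : ℤ) - 1)))⁻¹ := by
  rcases Nat.eq_zero_or_pos n with rfl | hn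
  · simp [qPoch]
  · rw [qPoch, if_neg (by omega)]
    simp

@[simp] theorem qPoch_zero (q a : ℂ) : qPoch q a 0 = 1 := by
  simp [qPoch]

/-- If no `(a;q)_n` vanishes, then no linear factor `1 - a q^n` vanishes. -/
theorem one_sub_mul_zpow_ne_zero {q a : ℂ} (h : ∀ n : ℤ, qPoch q a n ≠ 0) (n : ℤ) :
    1 - a * q ^ n ≠ 0 := by
  rcases le_or_gt 0 n with hn | hn
  · lift n to ℕ using hn
    have h' := h ((n + 1 : ℕ) : ℤ)
    rw [qPoch_ofNat, Finset.prod_range_succ] at h'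
    simpa using right_ne_zero_of_mul h'
  · obtain ⟨m, rfl⟩ : ∃ m : ℕ, n = -(m : ℤ) - 1 := ⟨(-n - 1).toNat, by omega⟩
    have h' := h (-((m + 1 : ℕ) : ℤ))
    rw [qPoch_neg_ofNat, Finset.prod_range_succ] at h'
    exact right_ne_zero_of_mul (fun h0 => h' (by rw [h0, inv_zero]))

theorem qPoch_ne_zero {q a : ℂ} (h : ∀ n : ℤ, 1 - a * q ^ n ≠ 0) (n : ℤ) :
    qPoch q a n ≠ 0 := by
  unfold qPoch
  split_ifs
  · exact Finset.prod_ne_zero_iff.mpr fun j _ => by simpa using h j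
  · exact inv_ne_zero (Finset.prod_ne_zero_iff.mpr fun j _ => h _)

theorem qPoch_add_one {q a : ℂ} (h : ∀ n : ℤ, 1 - a * q ^ n ≠ 0) (n : ℤ) :
    qPoch q a (n + 1) = qPoch q a n * (1 - a * q ^ n) := by
  rcases le_or_gt 0 n with hn | hn
  · lift n to ℕ using hn
    have := qPoch_ofNat q a (n + 1)
    rw [Finset.prod_range_succ, ← qPoch_ofNat] at this
    simpa using this
  · obtain ⟨m, rfl⟩ : ∃ m : ℕ, n = -(m : ℤ) - 1 := ⟨(-n - 1).toNat, by omega⟩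
    have h' := qPoch_neg_ofNat q a (m + 1)
    rw [Finset.prod_range_succ, mul_inv, ← qPoch_neg_ofNat] at h'
    rw [show -(m : ℤ) - 1 + 1 = -(m : ℤ) by ring,
      show (-(m : ℤ) - 1 : ℤ) = -((m + 1 : ℕ) : ℤ) by push_cast; ring, h']
    rw [show (-((m + 1 : ℕ) : ℤ) : ℤ) = -(m : ℤ) - 1 by push_cast; ring,
      inv_mul_cancel_right₀ (h _)]

theorem qPoch_mul_shift {q a : ℂ} (hq : q ≠ 0) (h : ∀ n : ℤ, 1 - a * q ^ n ≠ 0) (n : ℤ) :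
    qPoch q (a * q) n * (1 - a) = qPoch q a n * (1 - a * q ^ n) := by
  have h' : ∀ n : ℤ, 1 - a * q * q ^ n ≠ 0 := fun n => by
    have := h (n + 1)
    rwa [zpow_add_one₀ hq, mul_comm (q ^ n), ← mul_assoc] at this
  have step : ∀ i : ℤ, qPoch q (a * q) (i + 1) * (1 - a) =
      qPoch q a (i + 1) * (1 - a * q ^ (i + 1)) ↔
      qPoch q (a * q) i * (1 - a) = qPoch q a i * (1 - a * q ^ i) := fun i => by
    rw [qPoch_add_one h, qPoch_add_one h', ← mul_left_inj' (h' i) (b := qPoch q a i * _),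
      zpow_add_one₀ hq]
    constructor <;> intro e <;> linear_combination e
  induction n using Int.induction_on with
  | zero => simp
  | succ i ih => exact (step _).mpr ih
  | pred i ih => exact (step _).mp (by simpa using ih)

theorem qPoch_neg_mul {q a : ℂ} (hq : q ≠ 0) (ha : a ≠ 0)
    (h : ∀ n : ℤ, 1 - a * q ^ n ≠ 0) (n : ℕ) :
    qPoch q a (-(n : ℤ)) * qPoch q (q / a) n * a ^ n =
      ∏ j ∈ Finset.range n, (-q ^ (j + 1)) := by
  rw [qPoch_neg_ofNat, qPoch_ofNat]
  induction n with
  | zero => simp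
  | succ n ih =>
    have hn := h (-(n : ℤ) - 1)
    have e : q ^ (-(n : ℤ) - 1) = (q ^ (n + 1))⁻¹ := by
      rw [← zpow_natCast, ← zpow_neg]; congr 1; push_cast; ring
    have key : (1 - a * q ^ (-(n : ℤ) - 1))⁻¹ * (1 - q / a * q ^ n) * a = -q ^ (n + 1) := by
      rw [mul_assoc, inv_mul_eq_iff_eq_mul₀ hn, e]
      field_simp
      ring
    simp only [Finset.prod_range_succ, mul_inv, pow_succ a]
    rw [← ih, ← key]
    ring

theorem qPoch_eq_mul_shift {q a : ℂ} (hq : q ≠ 0) (h : ∀ n : ℤ, 1 - a * q ^ n ≠ 0) (n : ℤ) :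
    qPoch q a n = (1 - a) * qPoch q (a * q) (n - 1) := by
  have e := qPoch_mul_shift hq h (n - 1)
  rw [← qPoch_add_one h, sub_add_cancel] at e
  rw [← e, mul_comm]

theorem sum_Icc_neg_succ (f : ℤ → ℂ) (N : ℕ) :
    ∑ n ∈ Finset.Icc (-((N + 1 : ℕ) : ℤ)) ((N + 1 : ℕ) : ℤ), f n =
      ∑ n ∈ Finset.Icc (-(N : ℤ)) (N : ℤ), f n + f (N + 1) + f (-(N : ℤ) - 1) := by
  have e : Finset.Icc (-((N + 1 : ℕ) : ℤ)) ((N + 1 : ℕ) : ℤ) =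
      insert (-(N : ℤ) - 1) (insert ((N : ℤ) + 1) (Finset.Icc (-(N : ℤ)) (N : ℤ))) := by
    ext x; simp only [Finset.mem_Icc, Finset.mem_insert]; push_cast; omega
  rw [e, Finset.sum_insert, Finset.sum_insert]
  · ring
  · simp
  · simp only [Finset.mem_Icc, Finset.mem_insert]; omega

theorem sum_Icc_neg_telescope (k : ℤ → ℂ) (N : ℕ) :
    ∑ n ∈ Finset.Icc (-(N : ℤ)) (N : ℤ), (k (n - 1) - k n) = k (-(N : ℤ) - 1) - k N := by
  induction N with
  | zero => simp
  | succ N ih =>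
    rw [sum_Icc_neg_succ, ih]
    push_cast
    rw [show (N : ℤ) + 1 - 1 = N by ring, show -(N : ℤ) - 1 = -1 + -(N : ℤ) by ring]
    ring_nf

/-- The `n`-th term of the series `truncS`. -/
noncomputable def summand (q A B C D E : ℂ) (n : ℤ) : ℂ :=
  (1 - B*D*E*q^(2*n+1)/A) / (1 - B*D*E*q/A) *
    ((qPoch q (B*q) n * qPoch q (D*q) n * qPoch q (E*q) n * qPoch q (B*C*D*E*q^2/A^2) n) /
     (qPoch q (D*E*q/A) n * qPoch q (B*E*q/A) n * qPoch q (B*D*q/A) n * qPoch q (A/C) n)) *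
    (1/(C*q^2))^n

/-- The telescoping quantity whose backward difference relates the terms of the series for
`(A, C)` and `(A q, C q)`. -/
noncomputable def boundary (q A B C D E : ℂ) (n : ℤ) : ℂ :=
  A^2*q/(B*D*E) * (1 - B*D*E*q^(n-1)/A^2) *
    ((qPoch q (B*C*D*E*q^2/A^2) n * qPoch q (B*q) (n+1) *
        qPoch q (D*q) (n+1) * qPoch q (E*q) (n+1)) /
     ((1 - A*q/B) * (1 - A*q/D) * (1 - A*q/E) * (1 - B*D*E*q/A) *
      (qPoch q (A/C) n * qPoch q (B*D*q/A) n * qPoch q (B*E*q/A) n * qPoch q (D*E*q/A) n))) *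
    (1/(C*q^3))^n

/-- The first-order relation between the terms of the series for `(A, C)` and `(A q, C q)`. -/
theorem summand_eq_add_boundary_sub {q A B C D E : ℂ} (hq : q ≠ 0)
    (hA : A ≠ 0) (hB : B ≠ 0) (hC : C ≠ 0) (hD : D ≠ 0) (hE : E ≠ 0)
    (gDE : ∀ n : ℤ, 1 - D*E/A * q^n ≠ 0) (gBE : ∀ n : ℤ, 1 - B*E/A * q^n ≠ 0)
    (gBD : ∀ n : ℤ, 1 - B*D/A * q^n ≠ 0) (gAC : ∀ n : ℤ, 1 - A/C * q^n ≠ 0)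
    (gF : ∀ n : ℤ, 1 - B*C*D*E*q/A^2 * q^n ≠ 0) (gB : ∀ n : ℤ, 1 - B*q * q^n ≠ 0)
    (gD : ∀ n : ℤ, 1 - D*q * q^n ≠ 0) (gE : ∀ n : ℤ, 1 - E*q * q^n ≠ 0)
    (h1 : 1 - B*D*E*q/A ≠ 0) (h2 : 1 - B*D*E/A ≠ 0)
    (h4 : 1 - A*q/B ≠ 0) (h5 : 1 - A*q/D ≠ 0) (h6 : 1 - A*q/E ≠ 0) (n : ℤ) :
    summand q A B C D E n =
      A^2*q/(B*D*E) *
          (((1 - B*D*E/A) * (1 - C*q^3) * (1 - B*D/A) * (1 - B*E/A) * (1 - D*E/A)) /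
           ((1 - B*D*E*q/A) * (1 - B*C*D*E*q/A^2) * (1 - A*q/B) * (1 - A*q/D) * (1 - A*q/E))) *
          summand q (A*q) B (C*q) D E n +
        (boundary q A B C D E (n - 1) - boundary q A B C D E n) := by
  have up : ∀ {a b : ℂ}, (∀ n : ℤ, 1 - a * q^n ≠ 0) → a * q = b → ∀ n : ℤ,
      1 - b * q^n ≠ 0 := by
    rintro a _ h rfl n
    have := h (n + 1)
    rwa [zpow_add_one₀ hq, mul_comm (q ^ n), ← mul_assoc] at this
  have gDE' : ∀ n : ℤ, 1 - D*E*q/A * q^n ≠ 0 := up gDE (by ring)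
  have gBE' : ∀ n : ℤ, 1 - B*E*q/A * q^n ≠ 0 := up gBE (by ring)
  have gBD' : ∀ n : ℤ, 1 - B*D*q/A * q^n ≠ 0 := up gBD (by ring)
  have gF' : ∀ n : ℤ, 1 - B*C*D*E*q^2/A^2 * q^n ≠ 0 := up gF (by ring)
  have down : ∀ {a : ℂ}, (∀ n : ℤ, 1 - a * q^n ≠ 0) →
      qPoch q a n = qPoch q a (n - 1) * (1 - a * (q^n / q)) := by
    intro a h
    rw [div_eq_mul_inv, ← zpow_sub_one₀ hq, ← qPoch_add_one h, sub_add_cancel]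
  have low : ∀ {a b : ℂ}, (∀ n : ℤ, 1 - a * q^n ≠ 0) → a * q = b →
      qPoch q a n = (1 - a) * qPoch q b (n - 1) := by
    rintro a _ h rfl
    exact qPoch_eq_mul_shift hq h n
  have eDE : D*E*q/(A*q) = D*E/A := by field_simp
  have eBE : B*E*q/(A*q) = B*E/A := by field_simp
  have eBD : B*D*q/(A*q) = B*D/A := by field_simp
  have eAC : A*q/(C*q) = A/C := by field_simp
  have eF : B*(C*q)*D*E*q^2/(A*q)^2 = B*C*D*E*q/A^2 := by field_simp
  unfold summand boundary
  rw [eDE, eBE, eBD, eAC, eF]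
  rw [low gDE (b := D*E*q/A) (by ring), low gBE (b := B*E*q/A) (by ring),
    low gBD (b := B*D*q/A) (by ring), low gF (b := B*C*D*E*q^2/A^2) (by ring),
    down gDE', down gBE', down gBD', down gAC, down gF']
  rw [sub_add_cancel, qPoch_add_one gB, qPoch_add_one gD, qPoch_add_one gE]
  have hCq : 1/(C*q^3) ≠ 0 := one_div_ne_zero (mul_ne_zero hC (pow_ne_zero 3 hq))
  have y2 : (1/(C*q^2))^n = (1/(C*q^3))^(n-1) * (q^n / (C*q^3)) := by
    rw [zpow_sub_one₀ hCq]
    rw [show 1/(C*q^2) = 1/(C*q^3) * q by field_simp, mul_zpow]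
    field_simp
  have y3 : (1/(C*q^3))^n = (1/(C*q^3))^(n-1) * (1 / (C*q^3)) := by
    rw [← zpow_add_one₀ hCq, sub_add_cancel]
  rw [show C*q*q^2 = C*q^3 by ring, y2, y3]
  have x1 : q^(2*n+1) = (q^n)^2 * q := by
    rw [zpow_add_one₀ hq, mul_comm 2 n, zpow_mul]; rfl
  have x2 : q^(n-1) = q^n / q := zpow_sub_one₀ hq n
  have x3 : q^(n-1-1) = q^n / q / q := by rw [zpow_sub_one₀ hq, zpow_sub_one₀ hq]; rfl
  rw [x1, x2, x3]
  have n1 := qPoch_ne_zero gDE' (n - 1)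
  have n2 := qPoch_ne_zero gBE' (n - 1)
  have n3 := qPoch_ne_zero gBD' (n - 1)
  have n4 := qPoch_ne_zero gAC (n - 1)
  have m0 := gF 0
  have m1 := gDE n
  have m2 := gBE n
  have m3 := gBD n
  have m4 := gAC (n - 1)
  have m5 := gDE 0
  have m6 := gBE 0
  have m7 := gBD 0
  rw [zpow_zero, mul_one] at m0 m5 m6 m7
  rw [x2] at m4
  generalize (1/(C*q^3))^(n-1) = y
  generalize qPoch q (D*E*q/A) (n-1) = u at *
  generalize qPoch q (B*E*q/A) (n-1) = v at *
  generalize qPoch q (B*D*q/A) (n-1) = w at *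
  generalize qPoch q (A/C) (n-1) = z at *
  generalize qPoch q (B*C*D*E*q^2/A^2) (n-1) = f
  generalize qPoch q (B*q) n = b
  generalize qPoch q (D*q) n = d
  generalize qPoch q (E*q) n = e
  have hx : q^n ≠ 0 := zpow_ne_zero n hq
  clear up down low gDE gBE gBD gAC gF gDE' gBE' gBD' gF' gB gD gE x1 x2 x3 y2 y3 eDE eBE eBD eAC eF
  generalize q^n = x at *
  have l1 : A - B*D*E*q ≠ 0 := by intro h; apply h1; field_simp; linear_combination h
  have l2 : A - B*D*E ≠ 0 := by intro h; apply h2; field_simp; linear_combination h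
  have l4 : B - A*q ≠ 0 := by intro h; apply h4; field_simp; linear_combination h
  have l5 : D - A*q ≠ 0 := by intro h; apply h5; field_simp; linear_combination h
  have l6 : E - A*q ≠ 0 := by intro h; apply h6; field_simp; linear_combination h
  have p0 : A^2 - B*C*D*E*q ≠ 0 := by intro h; apply m0; field_simp; linear_combination h
  have p1 : A - D*E*x ≠ 0 := by intro h; apply m1; field_simp; linear_combination h
  have p2 : A - B*E*x ≠ 0 := by intro h; apply m2; field_simp; linear_combination h
  have p3 : A - B*D*x ≠ 0 := by intro h; apply m3; field_simp; linear_combination h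
  have p4 : C*q - A*x ≠ 0 := by intro h; apply m4; field_simp; linear_combination h
  have p5 : A - D*E ≠ 0 := by intro h; apply m5; field_simp; linear_combination h
  have p6 : A - B*E ≠ 0 := by intro h; apply m6; field_simp; linear_combination h
  have p7 : A - B*D ≠ 0 := by intro h; apply m7; field_simp; linear_combination h
  clear h1 h2 h4 h5 h6 m0 m1 m2 m3 m4 m5 m6 m7 hCq
  have r1 : 1 - B*D*E*q/A = (A - B*D*E*q)/A := by field_simp
  have r2 : 1 - B*D*E*q/(A*q) = (A - B*D*E)/A := by field_simp
  have r2' : 1 - B*D*E/A = (A - B*D*E)/A := by field_simp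
  have r3 : 1 - B*C*D*E*q/A^2 = (A^2 - B*C*D*E*q)/A^2 := by field_simp
  have r4 : 1 - A*q/B = (B - A*q)/B := by field_simp
  have r5 : 1 - A*q/D = (D - A*q)/D := by field_simp
  have r6 : 1 - A*q/E = (E - A*q)/E := by field_simp
  have t1 : 1 - D*E*q/A*(x/q) = (A - D*E*x)/A := by field_simp
  have t2 : 1 - B*E*q/A*(x/q) = (A - B*E*x)/A := by field_simp
  have t3 : 1 - B*D*q/A*(x/q) = (A - B*D*x)/A := by field_simp
  have t4 : 1 - A/C*(x/q) = (C*q - A*x)/(C*q) := by field_simp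
  have t5 : 1 - D*E/A = (A - D*E)/A := by field_simp
  have t6 : 1 - B*E/A = (A - B*E)/A := by field_simp
  have t7 : 1 - B*D/A = (A - B*D)/A := by field_simp
  rw [r1, r2, r2', r3, r4, r5, r6, t1, t2, t3, t4, t5, t6, t7]
  clear r1 r2 r2' r3 r4 r5 r6 t1 t2 t3 t4 t5 t6 t7
  generalize h_l1 : A - B*D*E*q = v_l1 at *
  generalize h_l2 : A - B*D*E = v_l2 at *
  generalize h_l4 : B - A*q = v_l4 at *
  generalize h_l5 : D - A*q = v_l5 at *
  generalize h_l6 : E - A*q = v_l6 at *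
  generalize h_p0 : A^2 - B*C*D*E*q = v_p0 at *
  generalize h_p1 : A - D*E*x = v_p1 at *
  generalize h_p2 : A - B*E*x = v_p2 at *
  generalize h_p3 : A - B*D*x = v_p3 at *
  generalize h_p4 : C*q - A*x = v_p4 at *
  generalize h_p5 : A - D*E = v_p5 at *
  generalize h_p6 : A - B*E = v_p6 at *
  generalize h_p7 : A - B*D = v_p7 at *
  field_simp
  subst h_l1 h_l2 h_l4 h_l5 h_l6 h_p0 h_p1 h_p2 h_p3 h_p4 h_p5 h_p6 h_p7
  ring

/-- The lower boundary contribution, written with `q`-shifted factorials of positive order. -/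
theorem summand_add_boundary_neg {q A B C D E : ℂ} (hq : q ≠ 0)
    (hA : A ≠ 0) (hB : B ≠ 0) (hC : C ≠ 0) (hD : D ≠ 0) (hE : E ≠ 0)
    (gDE : ∀ n : ℤ, 1 - D*E*q/A * q^n ≠ 0) (gBE : ∀ n : ℤ, 1 - B*E*q/A * q^n ≠ 0)
    (gBD : ∀ n : ℤ, 1 - B*D*q/A * q^n ≠ 0) (gAC : ∀ n : ℤ, 1 - A/C * q^n ≠ 0)
    (gF : ∀ n : ℤ, 1 - B*C*D*E*q^2/A^2 * q^n ≠ 0) (gB : ∀ n : ℤ, 1 - B*q * q^n ≠ 0)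
    (gD : ∀ n : ℤ, 1 - D*q * q^n ≠ 0) (gE : ∀ n : ℤ, 1 - E*q * q^n ≠ 0)
    (h1 : 1 - B*D*E*q/A ≠ 0)
    (h4 : 1 - A*q/B ≠ 0) (h5 : 1 - A*q/D ≠ 0) (h6 : 1 - A*q/E ≠ 0) (N : ℕ) :
    summand q A B C D E (-(N : ℤ) - 1) + boundary q A B C D E (-(N : ℤ) - 1) =
      (B*D*E/C * (1 - q^((N : ℤ)-1)/A) *
    ((qPoch q (A/(B*D)) ((N : ℤ)+2) * qPoch q (A/(B*E)) ((N : ℤ)+2) *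
        qPoch q (A/(D*E)) ((N : ℤ)+2) * qPoch q (C/A) ((N : ℤ)+2)) /
     ((1 - C/A) * (1 - A*q/B) * (1 - A*q/D) * (1 - A*q/E) * (1 - B*D*E*q/A) *
      (qPoch q (1/B) ((N : ℤ)+1) * qPoch q (1/D) ((N : ℤ)+1) * qPoch q (1/E) ((N : ℤ)+1) *
        qPoch q (A^2/(B*C*D*E*q)) ((N : ℤ)+1))))) / (C*q^3)^N := by
  obtain ⟨M, hM⟩ : ∃ M : ℕ, M = N + 1 := ⟨_, rfl⟩
  have c1 : (N : ℤ) + 1 = M := by rw [hM]; push_cast; ring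
  have c2 : (N : ℤ) + 2 = M + 1 := by rw [← c1]; ring
  have c3 : -(N : ℤ) - 1 = -M := by rw [← c1]; ring
  have c4 : (N : ℤ) - 1 = M - 1 - 1 := by rw [← c1]; ring
  have cN : (C*q^3)^N = C^M * (q^M)^3 / (C*q^3) := by rw [hM]; field_simp; ring
  have flip : ∀ {a b : ℂ}, (∀ n : ℤ, 1 - a * q^n ≠ 0) → q / a = b → a ≠ 0 → ∀ n : ℤ,
      1 - b * q^n ≠ 0 := by
    rintro a _ h rfl ha n h0
    apply h (-n - 1)
    rw [zpow_sub_one₀ hq, zpow_neg]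
    have hn : q^n ≠ 0 := zpow_ne_zero n hq
    field_simp at h0 ⊢
    linear_combination -h0
  obtain ⟨W, hW⟩ : ∃ W, W = ∏ j ∈ Finset.range M, (-q ^ (j + 1)) := ⟨_, rfl⟩
  have hW0 : W ≠ 0 := by
    rw [hW]
    exact Finset.prod_ne_zero_iff.mpr fun j _ => neg_ne_zero.mpr (pow_ne_zero _ hq)
  have refl : ∀ {a b : ℂ}, (∀ n : ℤ, 1 - a * q^n ≠ 0) → q / a = b → a ≠ 0 →
      qPoch q a (-(M : ℤ)) = W / (qPoch q b M * a^M) ∧ qPoch q b M ≠ 0 := by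
    rintro a _ h rfl ha
    have e := qPoch_neg_mul hq ha h M
    rw [← hW] at e
    have hne : qPoch q (q / a) M ≠ 0 := fun h0 => hW0 (by rw [← e, h0]; ring)
    refine ⟨?_, hne⟩
    rw [eq_div_iff (mul_ne_zero hne (pow_ne_zero _ ha)), ← e, mul_assoc]
  have zDE : D*E*q/A ≠ 0 := by simp [*]
  have zBE : B*E*q/A ≠ 0 := by simp [*]
  have zBD : B*D*q/A ≠ 0 := by simp [*]
  have zAC : A/C ≠ 0 := by simp [*]
  have zF : B*C*D*E*q^2/A^2 ≠ 0 := by simp [*]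
  have eDE : q / (D*E*q/A) = A/(D*E) := by field_simp
  have eBE : q / (B*E*q/A) = A/(B*E) := by field_simp
  have eBD : q / (B*D*q/A) = A/(B*D) := by field_simp
  have eAC : q / (A/C) = C/A*q := by field_simp
  have eF : q / (B*C*D*E*q^2/A^2) = A^2/(B*C*D*E*q) := by field_simp
  have eB : q / (B*q) = 1/B := by field_simp
  have eD : q / (D*q) = 1/D := by field_simp
  have eE : q / (E*q) = 1/E := by field_simp
  have gCA : ∀ n : ℤ, 1 - C/A * q^n ≠ 0 := fun n => by
    have := flip gAC eAC zAC (n - 1)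
    rwa [zpow_sub_one₀ hq, show C/A*q*(q^n*q⁻¹) = C/A*q^n by field_simp] at this
  obtain ⟨rDE, nDE⟩ := refl gDE eDE zDE
  obtain ⟨rBE, nBE⟩ := refl gBE eBE zBE
  obtain ⟨rBD, nBD⟩ := refl gBD eBD zBD
  obtain ⟨rAC, nAC⟩ := refl gAC eAC zAC
  obtain ⟨rF, nF⟩ := refl gF eF zF
  obtain ⟨rB, nB⟩ := refl gB eB (mul_ne_zero hB hq)
  obtain ⟨rD, nD⟩ := refl gD eD (mul_ne_zero hD hq)
  obtain ⟨rE, nE⟩ := refl gE eE (mul_ne_zero hE hq)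
  have h7 := gCA 0
  rw [zpow_zero, mul_one] at h7
  have x1 : q^(2*(-(M : ℤ))+1) = q / (q^M)^2 := by
    rw [zpow_add_one₀ hq, mul_comm, zpow_mul, zpow_neg, zpow_natCast, zpow_ofNat, pow_right_comm, div_eq_mul_inv]
  have x2 : q^(-(M : ℤ)-1) = 1 / (q^M * q) := by
    rw [zpow_sub_one₀ hq, zpow_neg, zpow_natCast]; field_simp
  have x3 : q^((M : ℤ)-1-1) = q^M / q^2 := by
    rw [zpow_sub_one₀ hq, zpow_sub_one₀ hq, zpow_natCast]; field_simp
  have y2 : (1/(C*q^2))^(-(M : ℤ)) = C^M * (q^M)^2 := by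
    rw [zpow_neg, zpow_natCast, one_div, inv_pow, inv_inv]; ring
  have y3 : (1/(C*q^3))^(-(M : ℤ)) = C^M * (q^M)^3 := by
    rw [zpow_neg, zpow_natCast, one_div, inv_pow, inv_inv]; ring
  have pDE : (D*E*q/A)^M = D^M*E^M*q^M/A^M := by rw [div_pow, mul_pow, mul_pow]
  have pBE : (B*E*q/A)^M = B^M*E^M*q^M/A^M := by rw [div_pow, mul_pow, mul_pow]
  have pBD : (B*D*q/A)^M = B^M*D^M*q^M/A^M := by rw [div_pow, mul_pow, mul_pow]
  have pF : (B*C*D*E*q^2/A^2)^M = B^M*C^M*D^M*E^M*(q^M)^2/(A^M)^2 := by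
    rw [div_pow, mul_pow, mul_pow, mul_pow, mul_pow, pow_right_comm q, pow_right_comm A]
  unfold summand boundary
  rw [c1, c2, c3, c4, cN, qPoch_add_one gB, qPoch_add_one gD, qPoch_add_one gE,
    qPoch_add_one (flip gDE eDE zDE), qPoch_add_one (flip gBE eBE zBE),
    qPoch_add_one (flip gBD eBD zBD), qPoch_eq_mul_shift hq gCA, add_sub_cancel_right,
    rDE, rBE, rBD, rAC, rF, rB, rD, rE, x1, x2, x3, y2, y3, pDE, pBE, pBD, pF,
    div_pow, mul_pow, mul_pow, mul_pow, zpow_neg, zpow_natCast]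
  have hx : q^M ≠ 0 := pow_ne_zero M hq
  have hAM : A^M ≠ 0 := pow_ne_zero M hA
  have hBM : B^M ≠ 0 := pow_ne_zero M hB
  have hCM : C^M ≠ 0 := pow_ne_zero M hC
  have hDM : D^M ≠ 0 := pow_ne_zero M hD
  have hEM : E^M ≠ 0 := pow_ne_zero M hE
  have l1 : A - B*D*E*q ≠ 0 := by intro h; apply h1; field_simp; linear_combination h
  have l4 : B - A*q ≠ 0 := by intro h; apply h4; field_simp; linear_combination h
  have l5 : D - A*q ≠ 0 := by intro h; apply h5; field_simp; linear_combination h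
  have l6 : E - A*q ≠ 0 := by intro h; apply h6; field_simp; linear_combination h
  have r1 : 1 - B*D*E*q/A = (A - B*D*E*q)/A := by field_simp
  have r4 : 1 - A*q/B = (B - A*q)/B := by field_simp
  have r5 : 1 - A*q/D = (D - A*q)/D := by field_simp
  have r6 : 1 - A*q/E = (E - A*q)/E := by field_simp
  rw [r1, r4, r5, r6]
  clear gDE gBE gBD gAC gF gB gD gE gCA flip refl rDE rBE rBD rAC rF rB rD rE x1 x2 x3 y2 y3
    pDE pBE pBD pF eDE eBE eBD eAC eF eB eD eE zDE zBE zBD zAC zF r1 r4 r5 r6 h1 h4 h5 h6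
    c1 c2 c3 c4 cN
  generalize qPoch q (A/(D*E)) M = u at *
  generalize qPoch q (A/(B*E)) M = v at *
  generalize qPoch q (A/(B*D)) M = w at *
  generalize qPoch q (C/A*q) M = z at *
  generalize qPoch q (A^2/(B*C*D*E*q)) M = f at *
  generalize qPoch q (1/B) M = b at *
  generalize qPoch q (1/D) M = d at *
  generalize qPoch q (1/E) M = e at *
  generalize q^M = x at *
  generalize A^M = a' at *
  generalize B^M = b' at *
  generalize C^M = c' at *
  generalize D^M = d' at *
  generalize E^M = e' at *
  generalize h_l1 : A - B*D*E*q = v_l1 at *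
  generalize h_l4 : B - A*q = v_l4 at *
  generalize h_l5 : D - A*q = v_l5 at *
  generalize h_l6 : E - A*q = v_l6 at *
  generalize h_s : 1 - C/A = s at *
  field_simp
  subst h_l1 h_l4 h_l5 h_l6
  ring

/-- The recurrence relation for the truncated very-well-poised `₆ψ₆` series:
`S_{N+1}(A;C) = K_N(A;B,C,D,E)/(Cq³)^N + (A²q/(BDE)) · [...] · S_N(Aq;Cq)`. -/
theorem truncS_recurrence (q A B C D E : ℂ) (hq0 : 0 < ‖q‖) (hq1 : ‖q‖ < 1)
    (hA : A ≠ 0) (hB : B ≠ 0) (hC : C ≠ 0) (hD : D ≠ 0) (hE : E ≠ 0)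
    (hgen : ∀ n : ℤ, qPoch q (D*E*q/A) n ≠ 0 ∧ qPoch q (B*E*q/A) n ≠ 0 ∧
      qPoch q (B*D*q/A) n ≠ 0 ∧ qPoch q (A/C) n ≠ 0 ∧
      qPoch q (D*E*q/(A*q)) n ≠ 0 ∧ qPoch q (B*E*q/(A*q)) n ≠ 0 ∧
      qPoch q (B*D*q/(A*q)) n ≠ 0 ∧ qPoch q ((A*q)/(C*q)) n ≠ 0 ∧
      qPoch q (1/B) n ≠ 0 ∧ qPoch q (1/D) n ≠ 0 ∧ qPoch q (1/E) n ≠ 0 ∧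
      qPoch q (A^2/(B*C*D*E*q)) n ≠ 0)
    (h1 : 1 - B*D*E*q/A ≠ 0) (h2 : 1 - B*D*E/A ≠ 0) (h3 : 1 - B*C*D*E*q/A^2 ≠ 0)
    (h4 : 1 - A*q/B ≠ 0) (h5 : 1 - A*q/D ≠ 0) (h6 : 1 - A*q/E ≠ 0) (h7 : 1 - C/A ≠ 0)
    (N : ℕ) :
    truncS q A B C D E (N+1)
      = Kterm q A B C D E N / (C*q^3)^N
        + A^2*q/(B*D*E) *
          (((1 - B*D*E/A) * (1 - C*q^3) * (1 - B*D/A) * (1 - B*E/A) * (1 - D*E/A)) /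
           ((1 - B*D*E*q/A) * (1 - B*C*D*E*q/A^2) * (1 - A*q/B) * (1 - A*q/D) * (1 - A*q/E))) *
          truncS q (A*q) B (C*q) D E N := by
  have hq : q ≠ 0 := norm_pos_iff.mp hq0
  have flip : ∀ {a b : ℂ} (m : ℤ), (∀ n : ℤ, qPoch q a n ≠ 0) → a * b = q^m → ∀ n : ℤ,
      1 - b * q^n ≠ 0 := by
    intro a b m h hab n h0
    apply one_sub_mul_zpow_ne_zero h (-m - n)
    rw [zpow_sub₀ hq, zpow_neg, ← hab]
    have hb : b ≠ 0 := right_ne_zero_of_mul (hab ▸ zpow_ne_zero m hq)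
    have ha : a ≠ 0 := left_ne_zero_of_mul (hab ▸ zpow_ne_zero m hq)
    have hn : q^n ≠ 0 := zpow_ne_zero n hq
    field_simp
    linear_combination -h0
  have up : ∀ {a b : ℂ}, (∀ n : ℤ, 1 - a * q^n ≠ 0) → a * q = b → ∀ n : ℤ,
      1 - b * q^n ≠ 0 := by
    rintro a _ h rfl n
    have := h (n + 1)
    rwa [zpow_add_one₀ hq, mul_comm (q ^ n), ← mul_assoc] at this
  have gDE : ∀ n : ℤ, 1 - D*E/A * q^n ≠ 0 := fun n => by
    simpa only [mul_div_mul_right _ _ hq] using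
      one_sub_mul_zpow_ne_zero (fun n => (hgen n).2.2.2.2.1) n
  have gBE : ∀ n : ℤ, 1 - B*E/A * q^n ≠ 0 := fun n => by
    simpa only [mul_div_mul_right _ _ hq] using
      one_sub_mul_zpow_ne_zero (fun n => (hgen n).2.2.2.2.2.1) n
  have gBD : ∀ n : ℤ, 1 - B*D/A * q^n ≠ 0 := fun n => by
    simpa only [mul_div_mul_right _ _ hq] using
      one_sub_mul_zpow_ne_zero (fun n => (hgen n).2.2.2.2.2.2.1) n
  have gAC : ∀ n : ℤ, 1 - A/C * q^n ≠ 0 :=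
    one_sub_mul_zpow_ne_zero fun n => (hgen n).2.2.2.1
  have gB : ∀ n : ℤ, 1 - B*q * q^n ≠ 0 :=
    flip 1 (fun n => (hgen n).2.2.2.2.2.2.2.2.1) (by rw [zpow_one]; field_simp)
  have gD : ∀ n : ℤ, 1 - D*q * q^n ≠ 0 :=
    flip 1 (fun n => (hgen n).2.2.2.2.2.2.2.2.2.1) (by rw [zpow_one]; field_simp)
  have gE : ∀ n : ℤ, 1 - E*q * q^n ≠ 0 :=
    flip 1 (fun n => (hgen n).2.2.2.2.2.2.2.2.2.2.1) (by rw [zpow_one]; field_simp)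
  have gF : ∀ n : ℤ, 1 - B*C*D*E*q/A^2 * q^n ≠ 0 :=
    flip 0 (fun n => (hgen n).2.2.2.2.2.2.2.2.2.2.2) (by rw [zpow_zero]; field_simp)
  have hS : truncS q A B C D E (N+1) =
      ∑ n ∈ Finset.Icc (-(N : ℤ)) (N : ℤ), summand q A B C D E n +
        summand q A B C D E (N + 1) + summand q A B C D E (-(N : ℤ) - 1) :=
    sum_Icc_neg_succ (summand q A B C D E) N
  have hS' : truncS q (A*q) B (C*q) D E N =
      ∑ n ∈ Finset.Icc (-(N : ℤ)) (N : ℤ), summand q (A*q) B (C*q) D E n := rfl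
  rw [hS, hS', Finset.sum_congr rfl fun n _ =>
      summand_eq_add_boundary_sub hq hA hB hC hD hE gDE gBE gBD gAC gF gB gD gE h1 h2 h4 h5 h6 n,
    Finset.sum_add_distrib, ← Finset.mul_sum, sum_Icc_neg_telescope]
  have lower := summand_add_boundary_neg hq hA hB hC hD hE (up gDE (by ring)) (up gBE (by ring))
    (up gBD (by ring)) gAC (up gF (by ring)) gB gD gE h1 h4 h5 h6 N
  have hCq : C*q^3 ≠ 0 := mul_ne_zero hC (pow_ne_zero 3 hq)
  have first : summand q A B C D E (N + 1) = (q^((N : ℤ) - 2)/C *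
      ((1 - B*D*E*q^(2*(N : ℤ)+3)/A) / (1 - B*D*E*q/A)) *
    ((qPoch q (B*q) ((N : ℤ)+1) * qPoch q (D*q) ((N : ℤ)+1) * qPoch q (E*q) ((N : ℤ)+1) *
        qPoch q (B*C*D*E*q^2/A^2) ((N : ℤ)+1)) /
     (qPoch q (A/C) ((N : ℤ)+1) * qPoch q (B*D*q/A) ((N : ℤ)+1) *
        qPoch q (B*E*q/A) ((N : ℤ)+1) * qPoch q (D*E*q/A) ((N : ℤ)+1)))) / (C*q^3)^N := by
    have y : (1/(C*q^2))^((N : ℤ)+1) = q^((N : ℤ) - 2)/C / (C*q^3)^N := by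
      rw [zpow_add_one₀ (one_div_ne_zero (mul_ne_zero hC (pow_ne_zero 2 hq))), zpow_sub₀ hq,
        zpow_natCast, zpow_natCast, div_pow, mul_pow, mul_pow, ← pow_mul, ← pow_mul]
      rw [show 3 * N = 2 * N + N by ring, pow_add]
      field_simp
      exact one_pow N
    unfold summand
    rw [y, show 2*((N : ℤ)+1)+1 = 2*(N : ℤ)+3 by ring]
    ring
  have upper : boundary q A B C D E N = (A^2*q/(B*D*E) *
    (((1 - B*q) * (1 - D*q) * (1 - E*q) * (1 - B*D*E*q^((N : ℤ)-1)/A^2)) *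
     (qPoch q (B*C*D*E*q^2/A^2) (N : ℤ) * qPoch q (B*q^2) (N : ℤ) *
        qPoch q (D*q^2) (N : ℤ) * qPoch q (E*q^2) (N : ℤ)) /
     ((1 - A*q/B) * (1 - A*q/D) * (1 - A*q/E) * (1 - B*D*E*q/A) *
      (qPoch q (A/C) (N : ℤ) * qPoch q (B*D*q/A) (N : ℤ) *
        qPoch q (B*E*q/A) (N : ℤ) * qPoch q (D*E*q/A) (N : ℤ))))) / (C*q^3)^N := by
    unfold boundary
    rw [qPoch_eq_mul_shift hq gB, qPoch_eq_mul_shift hq gD, qPoch_eq_mul_shift hq gE,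
      add_sub_cancel_right, zpow_natCast, one_div, inv_pow,
      show B*q*q = B*q^2 by ring, show D*q*q = D*q^2 by ring, show E*q*q = E*q^2 by ring]
    ring
  rw [Kterm, sub_div, add_div, ← first, ← upper, ← lower]
  ring
end

section
/- Let q, B, D, E, X be nonzero complex numbers with 0 < |q| < 1 and |1/(BDEXq⁴)| < 1, generic in the sense that every q-shifted factorial appearing in a denominator below is nonzero. Then T(X; 1/(BDEXq)) = (q²/X;q)_∞ (1/(BDXq²);q)_∞ (1/(BEXq²);q)_∞ (1/(DEXq²);q)_∞ / [(1/(BDEXq⁴);q)_∞ (1/(BX);q)_∞ (1/(DX);q)_∞ (1/(EX);q)_∞]. -/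
/-- The infinite `q`-shifted factorial `(a;q)_∞ = ∏_{j=0}^{∞} (1 - a q^j)`. -/
noncomputable def qPochInf (q a : ℂ) : ℂ := ∏' j : ℕ, (1 - a * q ^ j)

/-- The `n`-th term of the bilateral very-well-poised series `T(X;C)`:
`[(1 − BCDEX²q^{2n})/(1 − BCDEX²)] · (BCDEXq,BXq,DXq,EXq;q)_n /
(X,BCDX,BCEX,CDEX;q)_n · (C/q³)^n`. -/
noncomputable def Tterm (q B C D E X : ℂ) (n : ℤ) : ℂ :=
  (1 - B*C*D*E*X^2*q^(2*n)) / (1 - B*C*D*E*X^2) *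
  ((qPoch q (B*C*D*E*X*q) n * qPoch q (B*X*q) n * qPoch q (D*X*q) n * qPoch q (E*X*q) n) /
   (qPoch q X n * qPoch q (B*C*D*X) n * qPoch q (B*C*E*X) n * qPoch q (C*D*E*X) n)) *
  (C/q^3)^n

open Filter

/-- The finite product `∏_{j<n} (1 - a q^j)`. -/
noncomputable def qProd (q a : ℂ) (n : ℕ) : ℂ := ∏ j ∈ Finset.range n, (1 - a * q ^ j)

@[simp] lemma qProd_zero (q a : ℂ) : qProd q a 0 = 1 := by simp [qProd]

lemma qProd_succ (q a : ℂ) (n : ℕ) : qProd q a (n + 1) = qProd q a n * (1 - a * q ^ n) := by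
  simp [qProd, Finset.prod_range_succ]

lemma qProd_ne_zero {q a : ℂ} (h : ∀ j : ℕ, 1 - a * q ^ j ≠ 0) (n : ℕ) : qProd q a n ≠ 0 :=
  Finset.prod_ne_zero_iff.2 fun j _ => h j

lemma qProd_mul_qProd_shift (q a : ℂ) (N m : ℕ) :
    qProd q a N * qProd q (a * q ^ N) m = qProd q a (N + m) := by
  simp only [qProd, Finset.prod_range_add, mul_assoc, pow_add]

lemma one_sub_mul_qProd (q a : ℂ) (m : ℕ) :
    (1 - a) * qProd q (a * q) m = qProd q a m * (1 - a * q ^ m) := by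
  have h := qProd_mul_qProd_shift q a 1 m
  rw [add_comm, qProd_succ] at h
  simpa [qProd_succ] using h

lemma summable_neg_mul_pow {q : ℂ} (hq : ‖q‖ < 1) (a : ℂ) :
    Summable fun j : ℕ => ‖-(a * q ^ j)‖ := by
  simpa using (summable_geometric_of_lt_one (norm_nonneg q) hq).mul_left ‖a‖

lemma multipliable_one_sub_mul_pow {q : ℂ} (hq : ‖q‖ < 1) (a : ℂ) :
    Multipliable fun j : ℕ => 1 - a * q ^ j := by
  simpa [sub_eq_add_neg] using multipliable_one_add_of_summable (summable_neg_mul_pow hq a)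

lemma tendsto_qProd {q : ℂ} (hq : ‖q‖ < 1) (a : ℂ) :
    Tendsto (qProd q a) atTop (nhds (qPochInf q a)) :=
  (multipliable_one_sub_mul_pow hq a).tendsto_prod_tprod_nat

lemma qPochInf_ne_zero {q a : ℂ} (hq : ‖q‖ < 1) (h : ∀ j : ℕ, 1 - a * q ^ j ≠ 0) :
    qPochInf q a ≠ 0 := by
  have := tprod_one_add_ne_zero_of_summable (f := fun j : ℕ => -(a * q ^ j))
    (by simpa [sub_eq_add_neg] using h) (summable_neg_mul_pow hq a)
  simpa [qPochInf, sub_eq_add_neg] using this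

lemma one_sub_mul_pow_ne_zero {q a : ℂ} (h : qPochInf q a ≠ 0) (j : ℕ) : 1 - a * q ^ j ≠ 0 :=
  fun hj => h (tprod_of_exists_eq_zero ⟨j, hj⟩)

lemma exists_norm_qProd_le {q : ℂ} (hq : ‖q‖ < 1) (a : ℂ) : ∃ M, ∀ n, ‖qProd q a n‖ ≤ M := by
  obtain ⟨M, hM⟩ := (tendsto_qProd hq a).norm.bddAbove_range
  exact ⟨M, fun n => hM ⟨n, rfl⟩⟩

lemma exists_norm_qProd_inv_le {q a : ℂ} (hq : ‖q‖ < 1) (h : ∀ j : ℕ, 1 - a * q ^ j ≠ 0) :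
    ∃ M, ∀ n, ‖(qProd q a n)⁻¹‖ ≤ M := by
  obtain ⟨M, hM⟩ := ((tendsto_qProd hq a).inv₀ (qPochInf_ne_zero hq h)).norm.bddAbove_range
  exact ⟨M, fun n => hM ⟨n, rfl⟩⟩

/-- The `m`-th term of the very-well-poised `₆φ₅` series, without the factor `1 - a q^{2m}`. -/
noncomputable def rogersCore (q a b c d : ℂ) (m : ℕ) : ℂ :=
  (qProd q a m * qProd q b m * qProd q c m * qProd q d m) /
    ((1 - a) * (qProd q q m * qProd q (a * q / b) m * qProd q (a * q / c) m *
      qProd q (a * q / d) m)) * (a * q / (b * c * d)) ^ m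

/-- The `m`-th term of the very-well-poised `₆φ₅` series. -/
noncomputable def rogersTerm (q a b c d : ℂ) (m : ℕ) : ℂ :=
  (1 - a * q ^ (2 * m)) * rogersCore q a b c d m

lemma rogersCore_succ (q a b c d : ℂ) (m : ℕ) :
    rogersCore q a b c d (m + 1) = rogersCore q a b c d m *
      ((1 - a * q ^ m) * (1 - b * q ^ m) * (1 - c * q ^ m) * (1 - d * q ^ m) /
        ((1 - q * q ^ m) * ((1 - a * q / b * q ^ m) * (1 - a * q / c * q ^ m) *
          (1 - a * q / d * q ^ m))) * (a * q / (b * c * d))) := by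
  simp only [rogersCore, qProd_succ, pow_succ, div_eq_mul_inv, mul_inv]
  ring

lemma rogersCore_mul_q {q a b c d : ℂ} (m : ℕ) (ha : ∀ j : ℕ, 1 - a * q ^ j ≠ 0)
    (hb : ∀ j : ℕ, 1 - a * q / b * q ^ j ≠ 0) (hc : ∀ j : ℕ, 1 - a * q / c * q ^ j ≠ 0)
    (hd : ∀ j : ℕ, 1 - a * q / d * q ^ j ≠ 0) :
    rogersCore q (a * q) b c d m = rogersCore q a b c d m *
      ((1 - a * q ^ m) / (1 - a * q) * ((1 - a * q / b) * (1 - a * q / c) * (1 - a * q / d) /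
        ((1 - a * q / b * q ^ m) * (1 - a * q / c * q ^ m) * (1 - a * q / d * q ^ m))) *
          q ^ m) := by
  have shift : ∀ y : ℂ, (∀ j : ℕ, 1 - y * q ^ j ≠ 0) →
      qProd q (y * q) m = qProd q y m * (1 - y * q ^ m) / (1 - y) := fun y hy => by
    rw [eq_div_iff (by simpa using hy 0), mul_comm, one_sub_mul_qProd]
  have e : ∀ y : ℂ, a * q * q / y = a * q / y * q := fun y => by ring
  have ez : a * q * q / (b * c * d) = a * q / (b * c * d) * q := by ring
  rw [rogersCore, rogersCore, ez, e b, e c, e d, shift a ha, shift _ hb, shift _ hc, shift _ hd,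
    mul_pow]
  simp only [div_eq_mul_inv, mul_inv, inv_inv]
  ring

lemma rogers_certificate {b c d : ℂ} (q a x : ℂ) (hb : b ≠ 0) (hc : c ≠ 0) (hd : d ≠ 0) :
    (1 - a * q / (b * c * d)) * (1 - a * x ^ 2) *
        ((1 - a * q / b * x) * (1 - a * q / c * x) * (1 - a * q / d * x)) -
      (1 - a * q / (b * c)) * (1 - a * q / (b * d)) * (1 - a * q / (c * d)) *
        (1 - a * q * x ^ 2) * (1 - a * x) * x =
    (1 - a * x) * (1 - b * x) * (1 - c * x) * (1 - d * x) * (a * q / (b * c * d)) *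
        (a ^ 2 * q / (b * c * d) * (q * x) - 1) -
      (1 - x) * (a ^ 2 * q / (b * c * d) * x - 1) *
        ((1 - a * q / b * x) * (1 - a * q / c * x) * (1 - a * q / d * x)) := by
  field_simp
  ring

/-- The antidifference certifying the contiguous relation `a ↦ a q` of the `₆φ₅` series. -/
noncomputable def rogersAnti (q a b c d : ℂ) (m : ℕ) : ℂ :=
  (1 - a * q / b) * (1 - a * q / c) * (1 - a * q / d) *
    ((1 - q ^ m) * (a ^ 2 * q / (b * c * d) * q ^ m - 1)) * rogersCore q a b c d m

lemma rogersTerm_telescope {q a b c d : ℂ} (m : ℕ) (hb0 : b ≠ 0) (hc0 : c ≠ 0) (hd0 : d ≠ 0)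
    (hq : ∀ j : ℕ, 1 - q * q ^ j ≠ 0) (ha : ∀ j : ℕ, 1 - a * q ^ j ≠ 0)
    (hb : ∀ j : ℕ, 1 - a * q / b * q ^ j ≠ 0) (hc : ∀ j : ℕ, 1 - a * q / c * q ^ j ≠ 0)
    (hd : ∀ j : ℕ, 1 - a * q / d * q ^ j ≠ 0) :
    (1 - a * q / (b * c * d)) * (1 - a * q / b) * (1 - a * q / c) * (1 - a * q / d) *
        rogersTerm q a b c d m -
      (1 - a * q) * (1 - a * q / (b * c)) * (1 - a * q / (b * d)) * (1 - a * q / (c * d)) *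
        rogersTerm q (a * q) b c d m =
    rogersAnti q a b c d (m + 1) - rogersAnti q a b c d m := by
  have key := rogers_certificate q a (q ^ m) hb0 hc0 hd0
  rw [rogersAnti, rogersAnti, rogersTerm, rogersTerm, rogersCore_mul_q m ha hb hc hd,
    rogersCore_succ]
  have h1 : 1 - a * q ≠ 0 := by simpa using ha 1
  have hqm := hq m
  have hbm := hb m
  have hcm := hc m
  have hdm := hd m
  have e1 : q ^ (2 * m) = (q ^ m) ^ 2 := by ring
  have e2 : q ^ (m + 1) = q * q ^ m := by ring
  rw [e1, e2]
  generalize q ^ m = x at *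
  generalize rogersCore q a b c d m = T at *
  generalize a * q / (b * c * d) = z at *
  generalize a ^ 2 * q / (b * c * d) = w at *
  generalize a * q / (b * c) = bc at *
  generalize a * q / (b * d) = bd at *
  generalize a * q / (c * d) = cd at *
  generalize a * q / b = ub at *
  generalize a * q / c = uc at *
  generalize a * q / d = ud at *
  have hU : (1 - ub * x) * (1 - uc * x) * (1 - ud * x) ≠ 0 :=
    mul_ne_zero (mul_ne_zero hbm hcm) hdm
  clear ha hb hc hd hq hbm hcm hdm e1 e2 hb0 hc0 hd0
  generalize (1 - ub * x) * (1 - uc * x) * (1 - ud * x) = U at *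
  generalize 1 - a * q = e at *
  generalize 1 - q * x = s at *
  field_simp
  linear_combination (1 - ub) * (1 - uc) * (1 - ud) * T * key

lemma exists_norm_mul_le {ι : Type*} {f g : ι → ℂ} (hf : ∃ M, ∀ i, ‖f i‖ ≤ M)
    (hg : ∃ M, ∀ i, ‖g i‖ ≤ M) : ∃ M, ∀ i, ‖f i * g i‖ ≤ M := by
  obtain ⟨M, hM⟩ := hf
  obtain ⟨M', hM'⟩ := hg
  exact ⟨M * M', fun i => by
    rw [norm_mul]
    exact mul_le_mul (hM i) (hM' i) (norm_nonneg _) ((norm_nonneg _).trans (hM i))⟩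

lemma qProd_shift {q y : ℂ} (hy : ∀ j : ℕ, 1 - y * q ^ j ≠ 0) (N m : ℕ) :
    qProd q (y * q ^ N) m = qProd q y (N + m) * (qProd q y N)⁻¹ := by
  rw [eq_mul_inv_iff_mul_eq₀ (qProd_ne_zero hy N), ← qProd_mul_qProd_shift, mul_comm]

lemma rogersTerm_shift {q a b c d : ℂ} (ha : ∀ j : ℕ, 1 - a * q ^ j ≠ 0)
    (hb : ∀ j : ℕ, 1 - a * q / b * q ^ j ≠ 0) (hc : ∀ j : ℕ, 1 - a * q / c * q ^ j ≠ 0)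
    (hd : ∀ j : ℕ, 1 - a * q / d * q ^ j ≠ 0) (N m : ℕ) :
    rogersTerm q (a * q ^ N) b c d m =
      (1 - a * q ^ (N + 2 * m)) * (qProd q a (N + m) * (qProd q a (N + 1))⁻¹) *
        (qProd q b m * qProd q c m * qProd q d m * (qProd q q m)⁻¹) *
        (qProd q (a * q / b) N * (qProd q (a * q / b) (N + m))⁻¹) *
        (qProd q (a * q / c) N * (qProd q (a * q / c) (N + m))⁻¹) *
        (qProd q (a * q / d) N * (qProd q (a * q / d) (N + m))⁻¹) *
        (a * q / (b * c * d) * q ^ N) ^ m := by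
  have e : ∀ y : ℂ, a * q ^ N * q / y = a * q / y * q ^ N := fun y => by ring
  rw [rogersTerm, rogersCore, e, e, e, e, qProd_shift ha, qProd_shift hb, qProd_shift hc,
    qProd_shift hd, qProd_succ]
  simp only [div_eq_mul_inv, mul_inv, inv_inv, pow_add]
  ring

lemma exists_norm_rogersTerm_le {q a b c d : ℂ} (hq1 : ‖q‖ < 1)
    (hq : ∀ j : ℕ, 1 - q * q ^ j ≠ 0) (ha : ∀ j : ℕ, 1 - a * q ^ j ≠ 0)
    (hb : ∀ j : ℕ, 1 - a * q / b * q ^ j ≠ 0) (hc : ∀ j : ℕ, 1 - a * q / c * q ^ j ≠ 0)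
    (hd : ∀ j : ℕ, 1 - a * q / d * q ^ j ≠ 0) :
    ∃ M, ∀ N m : ℕ,
      ‖rogersTerm q (a * q ^ N) b c d m‖ ≤ M * ‖a * q / (b * c * d) * q ^ N‖ ^ m := by
  have P : ∀ (y : ℂ) (f : ℕ × ℕ → ℕ), ∃ M, ∀ i, ‖qProd q y (f i)‖ ≤ M := fun y f =>
    let ⟨M, hM⟩ := exists_norm_qProd_le hq1 y
    ⟨M, fun i => hM (f i)⟩
  have I : ∀ (y : ℂ) (_ : ∀ j : ℕ, 1 - y * q ^ j ≠ 0) (f : ℕ × ℕ → ℕ),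
      ∃ M, ∀ i, ‖(qProd q y (f i))⁻¹‖ ≤ M := fun y hy f =>
    let ⟨M, hM⟩ := exists_norm_qProd_inv_le hq1 hy
    ⟨M, fun i => hM (f i)⟩
  have F : ∃ M, ∀ i : ℕ × ℕ, ‖1 - a * q ^ (i.1 + 2 * i.2)‖ ≤ M := by
    refine ⟨1 + ‖a‖, fun i => (norm_sub_le _ _).trans ?_⟩
    rw [norm_one, norm_mul, norm_pow]
    gcongr
    exact mul_le_of_le_one_right (norm_nonneg _) (pow_le_one₀ (norm_nonneg _) hq1.le)
  have S : ∀ (y : ℂ) (_ : ∀ j : ℕ, 1 - y * q ^ j ≠ 0), ∃ M, ∀ i : ℕ × ℕ,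
      ‖qProd q y i.1 * (qProd q y (i.1 + i.2))⁻¹‖ ≤ M := fun y hy =>
    exists_norm_mul_le (P y fun i => i.1) (I y hy fun i => i.1 + i.2)
  obtain ⟨M, hM⟩ := exists_norm_mul_le (exists_norm_mul_le (exists_norm_mul_le
    (exists_norm_mul_le (exists_norm_mul_le F
      (exists_norm_mul_le (P a fun i => i.1 + i.2) (I a ha fun i => i.1 + 1)))
      (exists_norm_mul_le (exists_norm_mul_le (exists_norm_mul_le (P b fun i => i.2)
        (P c fun i => i.2)) (P d fun i => i.2)) (I q hq fun i => i.2)))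
    (S _ hb)) (S _ hc)) (S _ hd)
  refine ⟨M, fun N m => ?_⟩
  rw [rogersTerm_shift ha hb hc hd, norm_mul, norm_pow]
  exact mul_le_mul_of_nonneg_right (hM (N, m)) (by positivity)

lemma summable_rogersTerm {q a b c d : ℂ} (hq1 : ‖q‖ < 1)
    (hq : ∀ j : ℕ, 1 - q * q ^ j ≠ 0) (ha : ∀ j : ℕ, 1 - a * q ^ j ≠ 0)
    (hb : ∀ j : ℕ, 1 - a * q / b * q ^ j ≠ 0) (hc : ∀ j : ℕ, 1 - a * q / c * q ^ j ≠ 0)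
    (hd : ∀ j : ℕ, 1 - a * q / d * q ^ j ≠ 0) (hz : ‖a * q / (b * c * d)‖ < 1) :
    Summable (rogersTerm q a b c d) := by
  obtain ⟨M, hM⟩ := exists_norm_rogersTerm_le hq1 hq ha hb hc hd
  refine .of_norm_bounded
    ((summable_geometric_of_lt_one (norm_nonneg (a * q / (b * c * d))) hz).mul_left M)
    fun m => ?_
  simpa using hM 0 m

lemma tendsto_rogersAnti {q a b c d : ℂ} (hq1 : ‖q‖ < 1)
    (ha : ∀ j : ℕ, 1 - a * q ^ j ≠ 0) (hs : Summable (rogersTerm q a b c d)) :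
    Tendsto (rogersAnti q a b c d) atTop (nhds 0) := by
  have hp : Tendsto (fun m : ℕ => q ^ m) atTop (nhds 0) :=
    tendsto_pow_atTop_nhds_zero_of_norm_lt_one hq1
  have hp2 : Tendsto (fun m : ℕ => q ^ (2 * m)) atTop (nhds 0) :=
    hp.comp (tendsto_id.const_mul_atTop' two_pos)
  have hinv : Tendsto (fun m : ℕ => (1 - a * q ^ (2 * m))⁻¹) atTop (nhds (1 - a * 0)⁻¹) :=
    (tendsto_const_nhds.sub (hp2.const_mul a)).inv₀ (by simp)
  have key := ((((hp.const_sub 1).mul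
    ((hp.const_mul (a ^ 2 * q / (b * c * d))).sub_const 1)).const_mul
    ((1 - a * q / b) * (1 - a * q / c) * (1 - a * q / d))).mul hinv).mul
      hs.tendsto_atTop_zero
  rw [mul_zero] at key
  refine key.congr fun m => ?_
  rw [rogersAnti, rogersTerm, mul_assoc _ (_)⁻¹, inv_mul_cancel_left₀ (ha _)]

lemma one_sub_mul_q_mul_pow_ne_zero {q y : ℂ} (hy : ∀ j : ℕ, 1 - y * q ^ j ≠ 0) (N j : ℕ) :
    1 - y * q ^ N * q ^ j ≠ 0 := by
  simpa [mul_assoc, pow_add] using hy (N + j)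

/-- The contiguous relation `a ↦ a q` of the `₆φ₅` series. -/
lemma tsum_rogersTerm_contiguous {q a b c d : ℂ} (hq1 : ‖q‖ < 1) (hb0 : b ≠ 0) (hc0 : c ≠ 0)
    (hd0 : d ≠ 0) (hq : ∀ j : ℕ, 1 - q * q ^ j ≠ 0) (ha : ∀ j : ℕ, 1 - a * q ^ j ≠ 0)
    (hb : ∀ j : ℕ, 1 - a * q / b * q ^ j ≠ 0) (hc : ∀ j : ℕ, 1 - a * q / c * q ^ j ≠ 0)
    (hd : ∀ j : ℕ, 1 - a * q / d * q ^ j ≠ 0) (hz : ‖a * q / (b * c * d)‖ < 1) :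
    (1 - a * q / (b * c * d)) * (1 - a * q / b) * (1 - a * q / c) * (1 - a * q / d) *
        ∑' m, rogersTerm q a b c d m =
      (1 - a * q) * (1 - a * q / (b * c)) * (1 - a * q / (b * d)) * (1 - a * q / (c * d)) *
        ∑' m, rogersTerm q (a * q) b c d m := by
  have e : ∀ y : ℂ, a * q * q / y = a * q / y * q := fun y => by ring
  have hs := summable_rogersTerm hq1 hq ha hb hc hd hz
  have sh : ∀ y : ℂ, (∀ j : ℕ, 1 - y * q ^ j ≠ 0) → ∀ j : ℕ, 1 - y * q * q ^ j ≠ 0 :=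
    fun y hy => by simpa using one_sub_mul_q_mul_pow_ne_zero hy 1
  have hs' : Summable (rogersTerm q (a * q) b c d) := by
    refine summable_rogersTerm hq1 hq (sh a ha) ?_ ?_ ?_ ?_
    · rw [e]; exact sh _ hb
    · rw [e]; exact sh _ hc
    · rw [e]; exact sh _ hd
    · rw [e, norm_mul]
      exact mul_lt_one_of_nonneg_of_lt_one_left (norm_nonneg _) hz hq1.le
  have h1 := ((hs.hasSum.mul_left ((1 - a * q / (b * c * d)) * (1 - a * q / b) *
    (1 - a * q / c) * (1 - a * q / d))).sub (hs'.hasSum.mul_left ((1 - a * q) *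
      (1 - a * q / (b * c)) * (1 - a * q / (b * d)) * (1 - a * q / (c * d))))).tendsto_sum_nat
  simp only [rogersTerm_telescope _ hb0 hc0 hd0 hq ha hb hc hd, Finset.sum_range_sub] at h1
  have h0 : rogersAnti q a b c d 0 = 0 := by simp [rogersAnti]
  have h2 := (tendsto_rogersAnti hq1 ha hs).sub_const (rogersAnti q a b c d 0)
  rw [h0, sub_zero] at h2
  rw [h0] at h1
  exact sub_eq_zero.1 (tendsto_nhds_unique h1 h2)

lemma tsum_rogersTerm_iterate {q a b c d : ℂ} (hq1 : ‖q‖ < 1) (hb0 : b ≠ 0) (hc0 : c ≠ 0)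
    (hd0 : d ≠ 0) (hq : ∀ j : ℕ, 1 - q * q ^ j ≠ 0) (ha : ∀ j : ℕ, 1 - a * q ^ j ≠ 0)
    (hb : ∀ j : ℕ, 1 - a * q / b * q ^ j ≠ 0) (hc : ∀ j : ℕ, 1 - a * q / c * q ^ j ≠ 0)
    (hd : ∀ j : ℕ, 1 - a * q / d * q ^ j ≠ 0) (hz : ‖a * q / (b * c * d)‖ < 1) (N : ℕ) :
    qProd q (a * q / (b * c * d)) N * qProd q (a * q / b) N * qProd q (a * q / c) N *
        qProd q (a * q / d) N * ∑' m, rogersTerm q a b c d m =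
      qProd q (a * q) N * qProd q (a * q / (b * c)) N * qProd q (a * q / (b * d)) N *
        qProd q (a * q / (c * d)) N * ∑' m, rogersTerm q (a * q ^ N) b c d m := by
  induction N with
  | zero => simp
  | succ N ih =>
    have e : ∀ y : ℂ, a * q ^ N * q / y = a * q / y * q ^ N := fun y => by ring
    have e' : a * q ^ N * q = a * q * q ^ N := by ring
    have h := tsum_rogersTerm_contiguous (a := a * q ^ N) hq1 hb0 hc0 hd0 hq
      (one_sub_mul_q_mul_pow_ne_zero ha N) (e b ▸ one_sub_mul_q_mul_pow_ne_zero hb N)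
      (e c ▸ one_sub_mul_q_mul_pow_ne_zero hc N) (e d ▸ one_sub_mul_q_mul_pow_ne_zero hd N)
      (by
        rw [e, norm_mul, norm_pow]
        exact mul_lt_one_of_nonneg_of_lt_one_left (norm_nonneg _) hz
          (pow_le_one₀ (norm_nonneg _) hq1.le))
    simp only [e] at h
    rw [pow_succ, ← mul_assoc a]
    simp only [qProd_succ]
    rw [e'] at h ⊢
    linear_combination (1 - a * q / (b * c * d) * q ^ N) * (1 - a * q / b * q ^ N) *
      (1 - a * q / c * q ^ N) * (1 - a * q / d * q ^ N) * ih +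
      qProd q (a * q) N * qProd q (a * q / (b * c)) N * qProd q (a * q / (b * d)) N *
        qProd q (a * q / (c * d)) N * h

lemma tendsto_tsum_rogersTerm_shift {q a b c d : ℂ} (hq1 : ‖q‖ < 1)
    (hq : ∀ j : ℕ, 1 - q * q ^ j ≠ 0) (ha : ∀ j : ℕ, 1 - a * q ^ j ≠ 0)
    (hb : ∀ j : ℕ, 1 - a * q / b * q ^ j ≠ 0) (hc : ∀ j : ℕ, 1 - a * q / c * q ^ j ≠ 0)
    (hd : ∀ j : ℕ, 1 - a * q / d * q ^ j ≠ 0) (hz : ‖a * q / (b * c * d)‖ < 1) :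
    Tendsto (fun N : ℕ => ∑' m, rogersTerm q (a * q ^ N) b c d m) atTop (nhds 1) := by
  obtain ⟨M, hM⟩ := exists_norm_rogersTerm_le hq1 hq ha hb hc hd
  have hM0 : 0 ≤ M := by simpa using (norm_nonneg _).trans (hM 0 0)
  rw [← tsum_ite_eq (0 : ℕ) (fun _ => (1 : ℂ))]
  refine tendsto_tsum_of_dominated_convergence
    ((summable_geometric_of_lt_one (norm_nonneg (a * q / (b * c * d))) hz).mul_left M)
    (fun m => ?_) (.of_forall fun N m => ?_)
  · rcases eq_or_ne m 0 with rfl | hm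
    · refine tendsto_const_nhds.congr fun N => ?_
      simp [rogersTerm, rogersCore, mul_inv_cancel₀ (ha N)]
    · rw [if_neg hm]
      refine squeeze_zero_norm (fun N => hM N m) ?_
      have h := ((((tendsto_pow_atTop_nhds_zero_of_norm_lt_one hq1).const_mul
        (a * q / (b * c * d))).norm).pow m).const_mul M
      simpa [hm] using h
  · refine (hM N m).trans ?_
    rw [norm_mul, norm_pow]
    gcongr
    exact mul_le_of_le_one_right (norm_nonneg _) (pow_le_one₀ (norm_nonneg _) hq1.le)

/-- Rogers' nonterminating very-well-poised `₆φ₅` summation. -/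
theorem hasSum_rogersTerm {q a b c d : ℂ} (hq1 : ‖q‖ < 1) (hb0 : b ≠ 0) (hc0 : c ≠ 0)
    (hd0 : d ≠ 0) (ha : ∀ j : ℕ, 1 - a * q ^ j ≠ 0)
    (hz : ‖a * q / (b * c * d)‖ < 1) (hz0 : qPochInf q (a * q / (b * c * d)) ≠ 0)
    (hb : qPochInf q (a * q / b) ≠ 0) (hc : qPochInf q (a * q / c) ≠ 0)
    (hd : qPochInf q (a * q / d) ≠ 0) :
    HasSum (rogersTerm q a b c d)
      ((qPochInf q (a * q) * qPochInf q (a * q / (b * c)) * qPochInf q (a * q / (b * d)) *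
        qPochInf q (a * q / (c * d))) /
      (qPochInf q (a * q / (b * c * d)) * qPochInf q (a * q / b) * qPochInf q (a * q / c) *
        qPochInf q (a * q / d))) := by
  have hq : ∀ j : ℕ, 1 - q * q ^ j ≠ 0 := fun j h => by
    have h1 : ‖q * q ^ j‖ = 1 := by rw [← sub_eq_zero.1 h, norm_one]
    rw [← pow_succ', norm_pow] at h1
    exact (pow_lt_one₀ (norm_nonneg _) hq1 j.succ_ne_zero).ne h1
  have hb' := one_sub_mul_pow_ne_zero hb
  have hc' := one_sub_mul_pow_ne_zero hc
  have hd' := one_sub_mul_pow_ne_zero hd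
  have P := fun y => tendsto_qProd hq1 y
  have h1 := ((((P (a * q / (b * c * d))).mul (P (a * q / b))).mul (P (a * q / c))).mul
    (P (a * q / d))).mul_const (∑' m, rogersTerm q a b c d m)
  simp only [tsum_rogersTerm_iterate hq1 hb0 hc0 hd0 hq ha hb' hc' hd' hz] at h1
  have h2 := ((((P (a * q)).mul (P (a * q / (b * c)))).mul (P (a * q / (b * d)))).mul
    (P (a * q / (c * d)))).mul (tendsto_tsum_rogersTerm_shift hq1 hq ha hb' hc' hd' hz)
  have h3 := tendsto_nhds_unique h1 h2
  rw [mul_one] at h3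
  rw [← h3, mul_div_cancel_left₀ _ (mul_ne_zero (mul_ne_zero (mul_ne_zero hz0 hb) hc) hd)]
  exact (summable_rogersTerm hq1 hq ha hb' hc' hd' hz).hasSum

lemma qPoch_neg {q y : ℂ} (hq : q ≠ 0) (hy : y ≠ 0) (m : ℕ) :
    qPoch q y (-(m : ℤ)) =
      ((-y) ^ m * (∏ j ∈ Finset.range m, q ^ (-(j : ℤ) - 1)) * qProd q (q / y) m)⁻¹ := by
  rcases Nat.eq_zero_or_pos m with rfl | hm
  · simp [qPoch]
  · rw [qPoch, if_neg (by omega), neg_neg, Int.toNat_natCast, qProd,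
      ← Finset.card_range m, ← Finset.prod_const, Finset.card_range, ← Finset.prod_mul_distrib,
      ← Finset.prod_mul_distrib]
    refine congrArg _ (Finset.prod_congr rfl fun j _ => ?_)
    have h : q ^ (-(j : ℤ) - 1) = (q ^ j * q)⁻¹ := by
      rw [zpow_sub₀ hq, zpow_neg, zpow_natCast, zpow_one, mul_inv, div_eq_mul_inv]
    rw [h]
    field_simp
    ring

lemma qPoch_one_of_pos (q : ℂ) {n : ℤ} (hn : 0 < n) : qPoch q 1 n = 0 := by
  rw [qPoch, if_pos hn.le]
  exact Finset.prod_eq_zero (Finset.mem_range.2 (by omega : 0 < n.toNat)) (by simp)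

lemma Tterm_special_of_pos {q B D E X : ℂ} (hq : q ≠ 0) (hB : B ≠ 0) (hD : D ≠ 0) (hE : E ≠ 0)
    (hX : X ≠ 0) {n : ℤ} (hn : 0 < n) : Tterm q B (1/(B*D*E*X*q)) D E X n = 0 := by
  have h : B*(1/(B*D*E*X*q))*D*E*X*q = 1 := by field_simp
  rw [Tterm, h, qPoch_one_of_pos q hn]
  simp

lemma Tterm_special_neg {q B D E X : ℂ} (hq : q ≠ 0) (hB : B ≠ 0) (hD : D ≠ 0) (hE : E ≠ 0)
    (hX : X ≠ 0) (hqX : 1 - q / X ≠ 0) (m : ℕ) :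
    Tterm q B (1/(B*D*E*X*q)) D E X (-(m : ℤ)) =
      rogersTerm q (q / X) (B * q ^ 2) (D * q ^ 2) (E * q ^ 2) m := by
  have e0 : B*(1/(B*D*E*X*q))*D*E*X*q = 1 := by field_simp
  have e1 : B*(1/(B*D*E*X*q))*D*X = 1 / (E * q) := by field_simp
  have e2 : B*(1/(B*D*E*X*q))*E*X = 1 / (D * q) := by field_simp
  have e3 : (1/(B*D*E*X*q))*D*E*X = 1 / (B * q) := by field_simp
  have e4 : B*(1/(B*D*E*X*q))*D*E*X^2 = X / q := by field_simp
  have f : ∀ Y : ℂ, Y ≠ 0 → q / (1 / (Y * q)) = Y * q ^ 2 := fun Y hY => by field_simp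
  have g : ∀ Y : ℂ, Y ≠ 0 → q / X * q / (Y * q ^ 2) = q / (Y * X * q) := fun Y hY => by
    field_simp
  have ez : q / X * q / (B * q ^ 2 * (D * q ^ 2) * (E * q ^ 2)) =
      1 / (B * D * E * X * q ^ 4) := by field_simp
  have n : ∀ {Y : ℂ}, Y ≠ 0 → Y * X * q ≠ 0 := fun hY => mul_ne_zero (mul_ne_zero hY hX) hq
  have n' : ∀ {Y : ℂ}, Y ≠ 0 → 1 / (Y * q) ≠ 0 := fun hY =>
    one_div_ne_zero (mul_ne_zero hY hq)
  have hv : (∏ j ∈ Finset.range m, q ^ (-(j : ℤ) - 1)) ≠ 0 :=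
    Finset.prod_ne_zero_iff.2 fun j _ => zpow_ne_zero _ hq
  have hz2 : q ^ (2 * -(m : ℤ)) = ((q ^ m) ^ 2)⁻¹ := by
    rw [mul_neg, zpow_neg, ← pow_mul, mul_comm m]
    norm_cast
  have hXq : 1 - X / q ≠ 0 := fun h => hqX (by
    have : X = q := by field_simp at h; linear_combination -h
    rw [this, div_self hq, sub_self])
  have hpre : (1 - X / q * ((q ^ m) ^ 2)⁻¹) / (1 - X / q) =
      ((q ^ m) ^ 2)⁻¹ * ((1 - q / X * q ^ (2 * m)) / (1 - q / X)) := by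
    have hqm : q ^ m ≠ 0 := pow_ne_zero _ hq
    have hX' : X - q ≠ 0 := fun h => hqX (by rw [sub_eq_zero.1 h, div_self hq, sub_self])
    rw [div_eq_iff hXq, pow_mul' q 2 m]
    generalize q ^ m = x at *
    field_simp
    ring
  rw [Tterm, e0, e1, e2, e3, e4, hz2, hpre, qPoch_neg hq one_ne_zero,
    qPoch_neg hq (n hB), qPoch_neg hq (n hD), qPoch_neg hq (n hE), qPoch_neg hq hX,
    qPoch_neg hq (n' hE), qPoch_neg hq (n' hD), qPoch_neg hq (n' hB), f _ hB, f _ hD,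
    f _ hE, rogersTerm, rogersCore, g _ hB, g _ hD,
    g _ hE, ez, div_one, zpow_neg, zpow_natCast]
  generalize (∏ j ∈ Finset.range m, q ^ (-(j : ℤ) - 1)) = v at *
  have hpow : (1 / (B * D * E * X * q ^ 4)) ^ m = ((q ^ m) ^ 2)⁻¹ *
      ((-1) ^ m * (-(B*X*q)) ^ m * (-(D*X*q)) ^ m * (-(E*X*q)) ^ m)⁻¹ *
      ((-X) ^ m * (-(1/(E*q))) ^ m * (-(1/(D*q))) ^ m * (-(1/(B*q))) ^ m) *
      ((1/(B*D*E*X*q)/q^3) ^ m)⁻¹ := by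
    rw [← pow_mul, mul_comm m, pow_mul]
    simp only [← mul_pow, ← inv_pow]
    congr 1
    field_simp
  rw [hpow]
  have hv4 : (v * v⁻¹) ^ 4 = 1 := by rw [mul_inv_cancel₀ hv, one_pow]
  generalize (-(B*X*q)) ^ m = p1 at *
  generalize (-(D*X*q)) ^ m = p2 at *
  generalize (-(E*X*q)) ^ m = p3 at *
  generalize (-(1/(E*q))) ^ m = p4 at *
  generalize (-(1/(D*q))) ^ m = p5 at *
  generalize (-(1/(B*q))) ^ m = p6 at *
  generalize (1/(B*D*E*X*q)/q^3) ^ m = p7 at *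
  generalize (-X) ^ m = p8 at *
  refine Eq.trans ?_ (mul_one _)
  conv_rhs => arg 2; rw [← hv4]
  simp only [div_eq_mul_inv, mul_inv, inv_inv]
  ring

lemma sum_Icc_neg_eq_sum_range {M : Type*} [AddCommMonoid M] (f : ℤ → M)
    (hf : ∀ n, 0 < n → f n = 0) (N : ℕ) :
    ∑ n ∈ Finset.Icc (-(N : ℤ)) N, f n = ∑ m ∈ Finset.range (N + 1), f (-(m : ℤ)) := by
  rw [← Finset.sum_image (f := f) (g := fun m : ℕ => -(m : ℤ)) (fun a _ b _ h => by simpa using h)]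
  refine (Finset.sum_subset (fun n hn => ?_) fun n hn hn' => hf n ?_).symm
  · simp only [Finset.mem_image, Finset.mem_range] at hn
    obtain ⟨m, hm, rfl⟩ := hn
    rw [Finset.mem_Icc]
    omega
  · rw [Finset.mem_Icc] at hn
    by_contra h
    exact hn' (Finset.mem_image.2 ⟨(-n).toNat, by rw [Finset.mem_range]; omega, by omega⟩)

/-- Evaluation of `T(X;C)` at the special point `C = 1/(BDEXq)`, where the
bilateral series collapses to a `₆φ₅` series summable by Rogers' formula. -/
theorem T_special_value (q B D E X : ℂ) (hq0 : 0 < ‖q‖) (hq1 : ‖q‖ < 1)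
    (hB : B ≠ 0) (hD : D ≠ 0) (hE : E ≠ 0) (hX : X ≠ 0)
    (harg : ‖1/(B*D*E*X*q^4)‖ < 1)
    (hgen : ∀ n : ℤ, qPoch q X n ≠ 0 ∧
      qPoch q (B*(1/(B*D*E*X*q))*D*X) n ≠ 0 ∧
      qPoch q (B*(1/(B*D*E*X*q))*E*X) n ≠ 0 ∧
      qPoch q ((1/(B*D*E*X*q))*D*E*X) n ≠ 0)
    (h1 : 1 - B*(1/(B*D*E*X*q))*D*E*X^2 ≠ 0)
    (h2 : qPochInf q (1/(B*D*E*X*q^4)) ≠ 0) (h3 : qPochInf q (1/(B*X)) ≠ 0)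
    (h4 : qPochInf q (1/(D*X)) ≠ 0) (h5 : qPochInf q (1/(E*X)) ≠ 0) :
    Filter.Tendsto
      (fun N : ℕ => ∑ n ∈ Finset.Icc (-(N : ℤ)) (N : ℤ),
        Tterm q B (1/(B*D*E*X*q)) D E X n) atTop
      (nhds ((qPochInf q (q^2/X) * qPochInf q (1/(B*D*X*q^2)) *
          qPochInf q (1/(B*E*X*q^2)) * qPochInf q (1/(D*E*X*q^2))) /
        (qPochInf q (1/(B*D*E*X*q^4)) * qPochInf q (1/(B*X)) *
          qPochInf q (1/(D*X)) * qPochInf q (1/(E*X))))) := by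
  have hq : q ≠ 0 := norm_pos_iff.1 hq0
  have ha : ∀ j : ℕ, 1 - q / X * q ^ j ≠ 0 := fun j h => by
    refine (hgen (-((j + 1 : ℕ) : ℤ))).1 ?_
    rw [qPoch_neg hq hX, qProd_succ, h]
    simp
  have u : ∀ Y : ℂ, Y ≠ 0 → q / X * q / (Y * q ^ 2) = 1 / (Y * X) := fun Y hY => by field_simp
  have w : ∀ Y Z : ℂ, Y ≠ 0 → Z ≠ 0 →
      q / X * q / (Y * q ^ 2 * (Z * q ^ 2)) = 1 / (Y * Z * X * q ^ 2) := fun Y Z hY hZ => by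
    field_simp
  have ez : q / X * q / (B * q ^ 2 * (D * q ^ 2) * (E * q ^ 2)) =
      1 / (B * D * E * X * q ^ 4) := by field_simp
  have ea : q / X * q = q ^ 2 / X := by ring
  have hq2 : q ^ 2 ≠ 0 := pow_ne_zero 2 hq
  have h := hasSum_rogersTerm (a := q / X) (b := B * q ^ 2) (c := D * q ^ 2) (d := E * q ^ 2) hq1
    (mul_ne_zero hB hq2) (mul_ne_zero hD hq2) (mul_ne_zero hE hq2) ha (by rwa [ez]) (by rwa [ez])
    (by rwa [u B hB]) (by rwa [u D hD]) (by rwa [u E hE])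
  rw [ez, u B hB, u D hD, u E hE, w B D hB hD, w B E hB hE, w D E hD hE, ea] at h
  refine ((tendsto_add_atTop_iff_nat 1).2 h.tendsto_sum_nat).congr fun N => ?_
  rw [sum_Icc_neg_eq_sum_range _ fun n hn => Tterm_special_of_pos hq hB hD hE hX hn]
  exact Finset.sum_congr rfl fun m _ =>
    (Tterm_special_neg hq hB hD hE hX (by simpa using ha 0) m).symm
end
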